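/- Suppose Re s_k < 0 for k = 1, …, m, let ω ⊆ ℂ be open and star-shaped with respect to the origin, and let f be holomorphic on ω. Then p(θ)(H_p f) = f on ω; that is, H_p is a right inverse of the Fuchsian ordinary differential operator p(θ) on holomorphic functions on ω. -/

import Mathlib

open MeasureTheory Polynomial

/-- The operator `H_p` associated with roots `s_1, …, s_m`:
`(H_p f)(t) = ∫_{[0,1]^m} (∏_k σ_k^{-s_k-1}) f(σ_1⋯σ_m t) dσ`. -/
noncomputable def Hp {ι : Type*} [Fintype ι] (s : ι → ℂ) (f : ℂ → ℂ) (t : ℂ) : ℂ :=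
  ∫ σ : ι → ℝ in Set.Icc 0 1,
    (∏ k, ((σ k : ℂ) ^ (-(s k) - 1))) * f ((∏ k, ((σ k : ℝ) : ℂ)) * t)

/-- The Euler operator `θu = t·u'(t)`. -/
noncomputable def eulerOp (u : ℂ → ℂ) : ℂ → ℂ := fun t => t * deriv u t

/-- For a polynomial `q(s) = ∑_j c_j s^j`, the operator `q(θ)u = ∑_j c_j θ^j u`. -/
noncomputable def polyEuler (q : Polynomial ℂ) (u : ℂ → ℂ) : ℂ → ℂ := fun t =>
  ∑ j ∈ Finset.range (q.natDegree + 1), q.coeff j * (eulerOp^[j] u) t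
section PolyEuler

lemma polyEuler_eq_sum (q : Polynomial ℂ) (u : ℂ → ℂ) (t : ℂ) :
    polyEuler q u t = q.sum fun j c => c * (eulerOp^[j] u) t :=
  (q.sum_over_range (f := fun j c => c * (eulerOp^[j] u) t) fun _ => zero_mul _).symm

lemma polyEuler_add (p q : Polynomial ℂ) (u : ℂ → ℂ) (t : ℂ) :
    polyEuler (p + q) u t = polyEuler p u t + polyEuler q u t := by
  simp only [polyEuler_eq_sum]
  exact Polynomial.sum_add_index p q _ (fun _ => zero_mul _) fun _ _ _ => add_mul _ _ _

lemma polyEuler_monomial (n : ℕ) (c : ℂ) (u : ℂ → ℂ) (t : ℂ) :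
    polyEuler (monomial n c) u t = c * (eulerOp^[n] u) t := by
  rw [polyEuler_eq_sum]
  exact Polynomial.sum_monomial_index _ _ (zero_mul _)

variable {ω : Set ℂ}

lemma Set.EqOn.eulerOp (hω : IsOpen ω) {u v : ℂ → ℂ} (h : Set.EqOn u v ω) :
    Set.EqOn (eulerOp u) (eulerOp v) ω := fun t ht => by
  simp only [_root_.eulerOp, (h.eventuallyEq_of_mem (hω.mem_nhds ht)).deriv_eq]

lemma Set.EqOn.eulerOp_iterate (hω : IsOpen ω) {u v : ℂ → ℂ} (h : Set.EqOn u v ω) (n : ℕ) :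
    Set.EqOn (_root_.eulerOp^[n] u) (_root_.eulerOp^[n] v) ω := by
  induction n generalizing u v with
  | zero => exact h
  | succ n ih => exact ih (h.eulerOp hω)

lemma Set.EqOn.polyEuler (hω : IsOpen ω) {u v : ℂ → ℂ} (h : Set.EqOn u v ω) (q : Polynomial ℂ) :
    Set.EqOn (polyEuler q u) (polyEuler q v) ω := fun t ht =>
  Finset.sum_congr rfl fun j _ => by rw [h.eulerOp_iterate hω j ht]

lemma DifferentiableOn.eulerOp (hω : IsOpen ω) {u : ℂ → ℂ} (hu : DifferentiableOn ℂ u ω) :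
    DifferentiableOn ℂ (eulerOp u) ω :=
  differentiableOn_id.mul (hu.deriv hω)

lemma eulerOp_iterate_sub_const_mul (hω : IsOpen ω) {u v : ℂ → ℂ} (hu : DifferentiableOn ℂ u ω)
    (hv : DifferentiableOn ℂ v ω) (a : ℂ) (n : ℕ) :
    Set.EqOn (eulerOp^[n] fun t => u t - a * v t)
      (fun t => (eulerOp^[n] u) t - a * (eulerOp^[n] v) t) ω := by
  induction n generalizing u v with
  | zero => exact fun _ _ => rfl
  | succ n ih =>
    refine Set.EqOn.trans (Set.EqOn.eulerOp_iterate hω (fun t ht => ?_) n)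
      (ih (hu.eulerOp hω) (hv.eulerOp hω))
    have h1 := (hu.differentiableAt (hω.mem_nhds ht)).hasDerivAt
    have h2 := (hv.differentiableAt (hω.mem_nhds ht)).hasDerivAt
    simp only [eulerOp]
    rw [(h1.fun_sub (h2.const_mul a)).deriv]
    ring

lemma polyEuler_mul_X_sub_C (hω : IsOpen ω) {u : ℂ → ℂ} (hu : DifferentiableOn ℂ u ω) (a : ℂ)
    (q : Polynomial ℂ) {t : ℂ} (ht : t ∈ ω) :
    polyEuler (q * (X - C a)) u t = polyEuler q (fun z => eulerOp u z - a * u z) t := by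
  induction q using Polynomial.induction_on' with
  | add p q hp hq => rw [add_mul, polyEuler_add, polyEuler_add, hp, hq]
  | monomial n c =>
    have h : monomial n c * (X - C a) = monomial (n + 1) c + monomial n (-(c * a)) := by
      rw [mul_sub, monomial_mul_X, monomial_mul_C, map_neg, sub_eq_add_neg]
    rw [h, polyEuler_add, polyEuler_monomial, polyEuler_monomial, polyEuler_monomial,
      eulerOp_iterate_sub_const_mul hω (hu.eulerOp hω) hu a n ht, Function.iterate_succ_apply]
    ring

end PolyEuler

lemma integrable_cpow_neg_sub_one {a : ℂ} (ha : a.re < 0) :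
    Integrable (fun x : ℝ => (x : ℂ) ^ (-a - 1)) (volume.restrict (Set.Icc 0 1)) := by
  have h := intervalIntegral.intervalIntegrable_cpow' (a := 0) (b := 1) (r := -a - 1)
    (by simp; linarith)
  rwa [intervalIntegrable_iff_integrableOn_Icc_of_le zero_le_one] at h

section StarShaped

variable {ω : Set ℂ}

lemma exists_bound_comp_smul
    (hstar : ∀ t ∈ ω, ∀ σ : ℝ, 0 ≤ σ → σ ≤ 1 → (σ : ℂ) * t ∈ ω)
    {g : ℂ → ℂ} (hg : ContinuousOn g ω) {K : Set ℂ} (hK : IsCompact K)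
    (hKω : K ⊆ ω) :
    ∃ M : ℝ, ∀ t ∈ K, ∀ x ∈ Set.Icc (0 : ℝ) 1, ‖g (x * t)‖ ≤ M := by
  have hc : IsCompact ((fun q : ℝ × ℂ => (q.1 : ℂ) * q.2) '' (Set.Icc 0 1 ×ˢ K)) :=
    (isCompact_Icc.prod hK).image (by fun_prop)
  obtain ⟨M, hM⟩ := hc.exists_bound_of_continuousOn (f := g) (hg.mono (by
    rintro _ ⟨q, ⟨h1, h2⟩, rfl⟩
    exact hstar _ (hKω h2) _ h1.1 h1.2))
  exact ⟨M, fun t ht x hx => hM _ ⟨(x, t), ⟨hx, ht⟩, rfl⟩⟩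

lemma continuousOn_comp_smul
    (hstar : ∀ t ∈ ω, ∀ σ : ℝ, 0 ≤ σ → σ ≤ 1 → (σ : ℂ) * t ∈ ω)
    {g : ℂ → ℂ} (hg : ContinuousOn g ω) {t : ℂ} (ht : t ∈ ω) :
    ContinuousOn (fun x : ℝ => g (x * t)) (Set.Icc 0 1) :=
  hg.comp (by fun_prop) fun x hx => hstar t ht x hx.1 hx.2

lemma integrable_prod_cpow_mul
    (hstar : ∀ t ∈ ω, ∀ σ : ℝ, 0 ≤ σ → σ ≤ 1 → (σ : ℂ) * t ∈ ω)
    {ι : Type*} [Fintype ι] {s : ι → ℂ} (hs : ∀ k, (s k).re < 0)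
    {f : ℂ → ℂ} (hf : ContinuousOn f ω) {t : ℂ} (ht : t ∈ ω) :
    Integrable (fun σ : ι → ℝ =>
        (∏ k, ((σ k : ℂ) ^ (-(s k) - 1))) * f ((∏ k, ((σ k : ℝ) : ℂ)) * t))
      (Measure.pi fun _ => volume.restrict (Set.Icc 0 1)) := by
  have hmem : ∀ σ ∈ Set.Icc (0 : ι → ℝ) 1, ∏ k, σ k ∈ Set.Icc (0 : ℝ) 1 := fun σ hσ =>
    ⟨Finset.prod_nonneg fun k _ => hσ.1 k,
      Finset.prod_le_one (fun k _ => hσ.1 k) fun k _ => hσ.2 k⟩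
  have hμ : (Measure.pi fun _ : ι => (volume : Measure ℝ).restrict (Set.Icc 0 1)) =
      volume.restrict (Set.Icc (0 : ι → ℝ) 1) := by
    rw [← Measure.restrict_pi_pi, ← Set.pi_univ_Icc]; rfl
  obtain ⟨M, hM⟩ := exists_bound_comp_smul hstar hf isCompact_singleton
    (Set.singleton_subset_iff.2 ht)
  refine (Integrable.fintype_prod fun k => integrable_cpow_neg_sub_one (hs k)).mul_bdd
    (c := M) ?_ ?_
  · rw [hμ]
    refine ContinuousOn.aestronglyMeasurable ?_ measurableSet_Icc
    have h := (continuousOn_comp_smul hstar hf ht).comp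
      (f := fun σ : ι → ℝ => ∏ k, σ k) (by fun_prop) hmem
    simpa [Function.comp_def] using h
  · rw [hμ]
    filter_upwards [ae_restrict_mem measurableSet_Icc] with σ hσ
    simpa using hM t rfl _ (hmem σ hσ)

/-- Fubini: the operator `H_p` splits off its first root. -/
lemma Hp_succ
    (hstar : ∀ t ∈ ω, ∀ σ : ℝ, 0 ≤ σ → σ ≤ 1 → (σ : ℂ) * t ∈ ω)
    {n : ℕ} {s : Fin (n + 1) → ℂ} (hs : ∀ k, (s k).re < 0)
    {f : ℂ → ℂ} (hf : ContinuousOn f ω) {t : ℂ} (ht : t ∈ ω) :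
    Hp s f t = ∫ x : ℝ in Set.Icc 0 1,
      (x : ℂ) ^ (-(s 0) - 1) * Hp (fun k : Fin n => s k.succ) f (x * t) := by
  have hμ (ι : Type) [Fintype ι] : volume.restrict (Set.Icc (0 : ι → ℝ) 1) =
      (Measure.pi fun _ : ι => (volume : Measure ℝ).restrict (Set.Icc 0 1)) := by
    rw [← Measure.restrict_pi_pi, ← Set.pi_univ_Icc]; rfl
  have hmp := measurePreserving_piFinSuccAbove
    (fun _ : Fin (n + 1) => (volume : Measure ℝ).restrict (Set.Icc 0 1)) 0
  let G : ℝ × (Fin n → ℝ) → ℂ := fun y =>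
    ((y.1 : ℂ) ^ (-(s 0) - 1) * ∏ k, ((y.2 k : ℂ) ^ (-(s k.succ) - 1))) *
      f ((y.1 * ∏ k, ((y.2 k : ℝ) : ℂ)) * t)
  have hG : (fun σ : Fin (n + 1) → ℝ =>
      (∏ k, ((σ k : ℂ) ^ (-(s k) - 1))) * f ((∏ k, ((σ k : ℝ) : ℂ)) * t)) =
      G ∘ MeasurableEquiv.piFinSuccAbove (fun _ => ℝ) 0 := by
    funext σ
    simp [G, Fin.prod_univ_succ, MeasurableEquiv.piFinSuccAbove, Fin.insertNthEquiv, Fin.tail]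
  have hint := integrable_prod_cpow_mul hstar hs hf ht
  rw [hG, hmp.integrable_comp_emb (MeasurableEquiv.measurableEmbedding _)] at hint
  simp only [Hp, hμ]
  rw [hG]
  refine (hmp.integral_comp' G).trans ((integral_prod _ hint).trans ?_)
  congr 1 with x
  rw [← integral_const_mul]
  congr 1 with y
  simp only [G]
  ring_nf

/-- The one-variable operator `f ↦ ∫₀¹ σ^{-a-1} f(σt) dσ` inverts `θ - a`. -/
lemma exists_hasDerivAt_integral_cpow_mul (hω : IsOpen ω)
    (hstar : ∀ t ∈ ω, ∀ σ : ℝ, 0 ≤ σ → σ ≤ 1 → (σ : ℂ) * t ∈ ω) {a : ℂ} (ha : a.re < 0)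
    {f : ℂ → ℂ} (hf : DifferentiableOn ℂ f ω) {t : ℂ} (ht : t ∈ ω) :
    ∃ d : ℂ, HasDerivAt (fun z => ∫ x : ℝ in Set.Icc 0 1, (x : ℂ) ^ (-a - 1) * f (x * z)) d t ∧
      t * d - a * (∫ x : ℝ in Set.Icc 0 1, (x : ℂ) ^ (-a - 1) * f (x * t)) = f t := by
  have hfd : ∀ z ∈ ω, HasDerivAt f (deriv f z) z := fun z hz =>
    (hf.differentiableAt (hω.mem_nhds hz)).hasDerivAt
  have hd : ContinuousOn (deriv f) ω := (hf.deriv hω).continuousOn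
  have hI := integrable_cpow_neg_sub_one ha
  have hmul : ∀ {g : ℂ → ℂ}, ContinuousOn g ω → ∀ {z : ℂ}, z ∈ ω →
      Integrable (fun x : ℝ => (x : ℂ) ^ (-a - 1) * g (x * z))
        (volume.restrict (Set.Icc 0 1)) := by
    intro g hg z hz
    obtain ⟨M, hM⟩ := exists_bound_comp_smul hstar hg isCompact_singleton
      (Set.singleton_subset_iff.2 hz)
    refine hI.mul_bdd (c := M)
      ((continuousOn_comp_smul hstar hg hz).aestronglyMeasurable measurableSet_Icc) ?_
    filter_upwards [ae_restrict_mem measurableSet_Icc] with x hx using hM z rfl x hx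
  obtain ⟨ε, hε, hεω⟩ := Metric.nhds_basis_closedBall.mem_iff.1 (hω.mem_nhds ht)
  obtain ⟨M, hM⟩ := exists_bound_comp_smul hstar hd (isCompact_closedBall t ε) hεω
  obtain ⟨hF', hderiv⟩ := hasDerivAt_integral_of_dominated_loc_of_deriv_le
    (μ := volume.restrict (Set.Icc 0 1)) (x₀ := t)
    (F := fun (z : ℂ) (x : ℝ) => (x : ℂ) ^ (-a - 1) * f (x * z))
    (F' := fun (z : ℂ) (x : ℝ) => (x : ℂ) ^ (-a - 1) * (deriv f (x * z) * x))
    (bound := fun x : ℝ => ‖(x : ℂ) ^ (-a - 1)‖ * M)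
    (Metric.closedBall_mem_nhds t hε)
    (by
      filter_upwards [hω.mem_nhds ht] with z hz
      exact (hmul hf.continuousOn hz).aestronglyMeasurable)
    (hmul hf.continuousOn ht)
    (hI.aestronglyMeasurable.mul <| ContinuousOn.aestronglyMeasurable
      ((continuousOn_comp_smul hstar hd ht).mul (by fun_prop)) measurableSet_Icc)
    (by
      filter_upwards [ae_restrict_mem measurableSet_Icc] with x hx z hz
      have h1 : ‖(x : ℂ)‖ ≤ 1 := by
        rw [Complex.norm_real, Real.norm_of_nonneg hx.1]; exact hx.2
      rw [norm_mul, norm_mul]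
      gcongr
      exact (mul_le_of_le_one_right (norm_nonneg _) h1).trans (hM z hz x hx))
    (hI.norm.mul_const M)
    (by
      filter_upwards [ae_restrict_mem measurableSet_Icc] with x hx z hz
      have h1 : HasDerivAt (fun z : ℂ => (x : ℂ) * z) x z := by
        simpa using (hasDerivAt_id z).const_mul (x : ℂ)
      exact ((hfd _ (hstar z (hεω hz) x hx.1 hx.2)).comp z h1).const_mul _)
  refine ⟨_, hderiv, ?_⟩
  have ha0 : -a ≠ 0 := fun h => by simp [neg_eq_zero.1 h] at ha
  have hint := (hF'.const_mul t).sub ((hmul hf.continuousOn ht).const_mul a)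
  have hFTC := intervalIntegral.integral_eq_sub_of_hasDerivAt_of_le (a := 0) (b := 1)
    (f := fun x : ℝ => (x : ℂ) ^ (-a) * f (x * t))
    (f' := fun x : ℝ => t * ((x : ℂ) ^ (-a - 1) * (deriv f (x * t) * x)) -
      a * ((x : ℂ) ^ (-a - 1) * f (x * t))) zero_le_one
    (ContinuousOn.mul (fun x _ => (Complex.continuousAt_ofReal_cpow_const x (-a)
      (Or.inl (by simpa using ha))).continuousWithinAt)
      (continuousOn_comp_smul hstar hf.continuousOn ht))
    (by
      intro x hx
      have hx0 : (x : ℂ) ≠ 0 := by exact_mod_cast hx.1.ne'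
      have h1 : HasDerivAt (fun z : ℂ => z * t) t x := by
        simpa using (hasDerivAt_id (x : ℂ)).mul_const t
      have h2 := ((hfd _ (hstar t ht x hx.1.le hx.2.le)).comp (x : ℂ) h1).comp_ofReal
      refine ((hasDerivAt_ofReal_cpow_const hx.1.ne' ha0).mul h2).congr_deriv ?_
      have h3 : (x : ℂ) ^ (-a) = (x : ℂ) ^ (-a - 1) * x := by
        rw [Complex.cpow_sub _ _ hx0, Complex.cpow_one, div_mul_cancel₀ _ hx0]
      rw [h3]
      simp only [Function.comp_apply]
      ring)
    ((intervalIntegrable_iff_integrableOn_Icc_of_le zero_le_one).2 hint)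
  rw [intervalIntegral.integral_of_le zero_le_one, ← integral_Icc_eq_integral_Ioc,
    integral_sub (hF'.const_mul t) ((hmul hf.continuousOn ht).const_mul a),
    integral_const_mul, integral_const_mul] at hFTC
  simpa [Complex.zero_cpow ha0] using hFTC

lemma differentiableOn_Hp_and_polyEuler_Hp
    (hstar : ∀ t ∈ ω, ∀ σ : ℝ, 0 ≤ σ → σ ≤ 1 → (σ : ℂ) * t ∈ ω)
    (hω : IsOpen ω) {f : ℂ → ℂ}
    (hf : DifferentiableOn ℂ f ω) {n : ℕ} {s : Fin n → ℂ} (hs : ∀ k, (s k).re < 0) :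
    DifferentiableOn ℂ (Hp s f) ω ∧
      Set.EqOn (polyEuler (∏ k, (X - C (s k))) (Hp s f)) f ω := by
  induction n with
  | zero =>
    have h : Hp s f = f := by
      funext t
      simp [Hp, integral_unique, measureReal_def]
    rw [h]
    exact ⟨hf, fun t _ => by simp [polyEuler]⟩
  | succ n ih =>
    obtain ⟨hg, hpg⟩ := ih (s := fun k => s k.succ) fun k => hs _
    set g := Hp (fun k : Fin n => s k.succ) f
    set G : ℂ → ℂ := fun z => ∫ x : ℝ in Set.Icc 0 1, (x : ℂ) ^ (-(s 0) - 1) * g (x * z)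
    have hHG : Set.EqOn (Hp s f) G ω := fun t ht => Hp_succ hstar hs hf.continuousOn ht
    have hG : DifferentiableOn ℂ G ω := fun t ht => by
      obtain ⟨d, hd, -⟩ := exists_hasDerivAt_integral_cpow_mul hω hstar (hs 0) hg ht
      exact hd.differentiableAt.differentiableWithinAt
    have hθ : Set.EqOn (fun z => eulerOp G z - s 0 * G z) g ω := fun t ht => by
      obtain ⟨d, hd, h⟩ := exists_hasDerivAt_integral_cpow_mul hω hstar (hs 0) hg ht
      simp only [eulerOp]
      rw [hd.deriv]
      exact h
    refine ⟨hG.congr hHG, fun t ht => ?_⟩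
    rw [hHG.polyEuler hω _ ht, Fin.prod_univ_succ, mul_comm, polyEuler_mul_X_sub_C hω hG _ _ ht,
      hθ.polyEuler hω _ ht]
    exact hpg ht

end StarShaped

/-- `p(θ) H_p f = f` on `ω`: `H_p` is a right inverse of the Fuchsian ordinary
differential operator `p(θ)` on holomorphic functions on `ω`. -/
theorem statement4 (m : ℕ) (hm : 1 ≤ m) (s : Fin m → ℂ) (hs : ∀ k, (s k).re < 0)
    (ω : Set ℂ) (hω : IsOpen ω)
    (hstar : ∀ t ∈ ω, ∀ σ : ℝ, 0 ≤ σ → σ ≤ 1 → (σ : ℂ) * t ∈ ω)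
    (f : ℂ → ℂ) (hf : DifferentiableOn ℂ f ω) :
    ∀ t ∈ ω, polyEuler (∏ k, (X - C (s k))) (Hp s f) t = f t := by
  exact fun t ht => (differentiableOn_Hp_and_polyEuler_Hp hstar hω hf hs).2 ht
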